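/- Let σ_1,…,σ_k, ς_1,…,ς_κ ∈ ℂ be such that K and K̂ = Wᴴ K V are invertible at all of these points, let b ∈ ℂ^m and c ∈ ℂ^p be tangential directions, and let d^{(1)},…,d^{(k-1)} ∈ ℂ^m and δ^{(1)},…,δ^{(κ-1)} ∈ ℂ^m be scaling vectors. Define v_1 = K(σ_1)^{-1} B(σ_1) b, v_j = K(σ_j)^{-1} 𝔑(σ_{j-1}, d^{(j-1)}) v_{j-1} for 2 ≤ j ≤ k, and w_1 = K(ς_κ)^{-ᴴ} C(ς_κ)ᴴ c, w_i = K(ς_{κ-i+1})^{-ᴴ} 𝔑(ς_{κ-i+1}, δ^{(κ-i+1)})ᴴ w_{i-1} for 2 ≤ i ≤ κ. If v_1,…,v_k lie in the column space of V and w_1,…,w_κ lie in the column space of W, then for all 1 ≤ q ≤ k, 1 ≤ η ≤ κ, and every arbitrary scaling vector z ∈ ℂ^m, the bi-tangential interpolation condition cᴴ 𝔾_{q+η}(σ_1,…,σ_q, ς_{κ-η+1},…,ς_κ | d^{(1)},…,d^{(q-1)}, z, δ^{(κ-η+1)},…,δ^{(κ-1)}) b = cᴴ 𝔾̂_{q+η}(σ_1,…,σ_q,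 ς_{κ-η+1},…,ς_κ | d^{(1)},…,d^{(q-1)}, z, δ^{(κ-η+1)},…,δ^{(κ-1)}) b holds. -/

import Mathlib

open Matrix
open scoped Kronecker

namespace StructBilin

/-- Scaled sum of the bilinear terms: `𝔑(s, d) = ∑ i, d i • N i s`. -/
noncomputable def Nsum {n m : ℕ} (N : Fin m → ℂ → Matrix (Fin n) (Fin n) ℂ) (s : ℂ)
    (d : Fin m → ℂ) : Matrix (Fin n) (Fin n) ℂ :=
  ∑ i, d i • N i s

/-- Middle factor of the modified transfer function
`𝔾_{q+1}(σ 0, …, σ q | d 0, …, d (q-1)) = C (σ q) * gAux K B N σ d q`. -/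
noncomputable def gAux {n m : ℕ} (K : ℂ → Matrix (Fin n) (Fin n) ℂ)
    (B : ℂ → Matrix (Fin n) (Fin m) ℂ) (N : Fin m → ℂ → Matrix (Fin n) (Fin n) ℂ)
    (σ : ℕ → ℂ) (d : ℕ → Fin m → ℂ) : ℕ → Matrix (Fin n) (Fin m) ℂ
  | 0 => (K (σ 0))⁻¹ * B (σ 0)
  | j + 1 => (K (σ (j + 1)))⁻¹ * Nsum N (σ j) (d j) * gAux K B N σ d j

/-- The modified (scaled and summed) transfer function
`𝔾_{q+1}(σ 0, …, σ q | d 0, …, d (q-1))` (the level is `q + 1`, indices are 0-based). -/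
noncomputable def Gmod {n m p : ℕ} (C : ℂ → Matrix (Fin p) (Fin n) ℂ)
    (K : ℂ → Matrix (Fin n) (Fin n) ℂ) (B : ℂ → Matrix (Fin n) (Fin m) ℂ)
    (N : Fin m → ℂ → Matrix (Fin n) (Fin n) ℂ) (σ : ℕ → ℂ) (d : ℕ → Fin m → ℂ)
    (q : ℕ) : Matrix (Fin p) (Fin m) ℂ :=
  C (σ q) * gAux K B N σ d q

/-- Right tangential interpolation vectors:
`v 0 = K(σ 0)⁻¹ B(σ 0) b`, `v (j+1) = K(σ (j+1))⁻¹ 𝔑(σ j, d j) v j`. -/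
noncomputable def vtan {n m : ℕ} (K : ℂ → Matrix (Fin n) (Fin n) ℂ)
    (B : ℂ → Matrix (Fin n) (Fin m) ℂ) (N : Fin m → ℂ → Matrix (Fin n) (Fin n) ℂ)
    (σ : ℕ → ℂ) (d : ℕ → Fin m → ℂ) (b : Fin m → ℂ) : ℕ → Fin n → ℂ
  | 0 => (K (σ 0))⁻¹ *ᵥ (B (σ 0) *ᵥ b)
  | j + 1 => (K (σ (j + 1)))⁻¹ *ᵥ (Nsum N (σ j) (d j) *ᵥ vtan K B N σ d b j)

/-- Left tangential interpolation vectors (with reversed point sequence `τ` and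
scaling sequence `e`):
`w 0 = K(τ 0)^{-ᴴ} C(τ 0)ᴴ c`, `w (t+1) = K(τ (t+1))^{-ᴴ} 𝔑(τ (t+1), e t)ᴴ w t`. -/
noncomputable def wtan {n m p : ℕ} (C : ℂ → Matrix (Fin p) (Fin n) ℂ)
    (K : ℂ → Matrix (Fin n) (Fin n) ℂ) (N : Fin m → ℂ → Matrix (Fin n) (Fin n) ℂ)
    (τ : ℕ → ℂ) (e : ℕ → Fin m → ℂ) (c : Fin p → ℂ) : ℕ → Fin n → ℂ
  | 0 => ((K (τ 0))⁻¹)ᴴ *ᵥ ((C (τ 0))ᴴ *ᵥ c)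
  | t + 1 => ((K (τ (t + 1)))⁻¹)ᴴ *ᵥ ((Nsum N (τ (t + 1)) (e t))ᴴ *ᵥ wtan C K N τ e c t)

/-- Entrywise `t`-th complex derivative of a matrix-valued function. -/
noncomputable def mDeriv {α β : Type*} (t : ℕ) (f : ℂ → Matrix α β ℂ) (z : ℂ) :
    Matrix α β ℂ :=
  Matrix.of fun i j => iteratedDeriv t (fun w => f w i j) z

/-- Entrywise `t`-th complex derivative of a vector-valued function. -/
noncomputable def vDeriv {α : Type*} (t : ℕ) (f : ℂ → α → ℂ) (z : ℂ) : α → ℂ :=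
  fun i => iteratedDeriv t (fun w => f w i) z

/-- Partial derivative in the `i`-th coordinate of a function of countably many
complex variables. -/
noncomputable def pD (i : ℕ) (f : (ℕ → ℂ) → ℂ) (s : ℕ → ℂ) : ℂ :=
  deriv (fun z => f (Function.update s i z)) (s i)

/-- Mixed partial derivative `∂_{s_1^{ord 0} ⋯ s_t^{ord (t-1)}}` of a function of the
first `t` coordinates. -/
noncomputable def mixedD (ord : ℕ → ℕ) : ℕ → ((ℕ → ℂ) → ℂ) → (ℕ → ℂ) → ℂ
  | 0, f => f
  | t + 1, f => mixedD ord t ((pD t)^[ord t] f)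

/-- The Hermite chain
`hChain t = ∂^{ℓ (t)}(𝔑(·, d t) K⁻¹)(σ t) ⋯ ∂^{ℓ 0}(𝔑(·, d 0) K⁻¹ B)(σ 0)`. -/
noncomputable def hChain {n m : ℕ} (K : ℂ → Matrix (Fin n) (Fin n) ℂ)
    (B : ℂ → Matrix (Fin n) (Fin m) ℂ) (N : Fin m → ℂ → Matrix (Fin n) (Fin n) ℂ)
    (σ : ℕ → ℂ) (d : ℕ → Fin m → ℂ) (ℓ : ℕ → ℕ) : ℕ → Matrix (Fin n) (Fin m) ℂ
  | 0 => mDeriv (ℓ 0) (fun z => Nsum N z (d 0) * ((K z)⁻¹ * B z)) (σ 0)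
  | t + 1 =>
      mDeriv (ℓ (t + 1)) (fun z => Nsum N z (d (t + 1)) * (K z)⁻¹) (σ (t + 1)) *
        hChain K B N σ d ℓ t

/-- Right tangential Hermite interpolation vectors. -/
noncomputable def vHerm {n m : ℕ} (K : ℂ → Matrix (Fin n) (Fin n) ℂ)
    (B : ℂ → Matrix (Fin n) (Fin m) ℂ) (N : Fin m → ℂ → Matrix (Fin n) (Fin n) ℂ)
    (σ : ℕ → ℂ) (d : ℕ → Fin m → ℂ) (ℓ : ℕ → ℕ) (b : Fin m → ℂ) : ℕ → ℕ → Fin n → ℂ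
  | 0, j => mDeriv j (fun z => (K z)⁻¹ * B z) (σ 0) *ᵥ b
  | t + 1, j => (mDeriv j (fun z => (K z)⁻¹) (σ (t + 1)) * hChain K B N σ d ℓ t) *ᵥ b

/-- Left tangential Hermite interpolation vectors (with reversed sequences). -/
noncomputable def wHerm {n m p : ℕ} (C : ℂ → Matrix (Fin p) (Fin n) ℂ)
    (K : ℂ → Matrix (Fin n) (Fin n) ℂ) (N : Fin m → ℂ → Matrix (Fin n) (Fin n) ℂ)
    (τ : ℕ → ℂ) (e : ℕ → Fin m → ℂ) (eν : ℕ → ℕ) (c : Fin p → ℂ) : ℕ → ℕ → Fin n → ℂ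
  | 0, i => star (vDeriv i (fun z => Matrix.vecMul (star c) (C z * (K z)⁻¹)) (τ 0))
  | t + 1, j =>
      star (vDeriv j (fun z =>
        Matrix.vecMul (star (wHerm C K N τ e eν c t (eν t))) (Nsum N z (e t) * (K z)⁻¹))
        (τ (t + 1)))

/-- Column index type of the `j+1`-st subsystem transfer function (`m^(j+1)` indices). -/
def colT (m : ℕ) : ℕ → Type
  | 0 => Fin m
  | j + 1 => Fin m × colT m j

def colTFintype (m : ℕ) : ∀ j, Fintype (colT m j)
  | 0 => inferInstanceAs (Fintype (Fin m))
  | j + 1 => letI := colTFintype m j; inferInstanceAs (Fintype (Fin m × colT m j))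

attribute [instance] colTFintype

/-- Block index type (`m^j` indices). -/
def outT (m : ℕ) : ℕ → Type
  | 0 => Fin 1
  | j + 1 => Fin m × outT m j

def outTFintype (m : ℕ) : ∀ j, Fintype (outT m j)
  | 0 => inferInstanceAs (Fintype (Fin 1))
  | j + 1 => letI := outTFintype m j; inferInstanceAs (Fintype (Fin m × outT m j))

attribute [instance] outTFintype

/-- The horizontal concatenation `N(s) = [N_1(s) ⋯ N_m(s)]`. -/
noncomputable def Nbig {n m : ℕ} (N : Fin m → ℂ → Matrix (Fin n) (Fin n) ℂ) (s : ℂ) :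
    Matrix (Fin n) (Fin m × Fin n) ℂ :=
  Matrix.of fun i q => N q.1 s i q.2

/-- The vertical concatenation `Ñ(s)` of `N_1(s), …, N_m(s)`. -/
noncomputable def Ntil {n m : ℕ} (N : Fin m → ℂ → Matrix (Fin n) (Fin n) ℂ) (s : ℂ) :
    Matrix (Fin m × Fin n) (Fin n) ℂ :=
  Matrix.of fun q i => N q.1 s q.2 i

/-- State part of the `j+1`-st subsystem transfer function:
`Z 0 = K(σ 0)⁻¹ B(σ 0)`, `Z (j+1) = K(σ (j+1))⁻¹ N(σ j) (I_m ⊗ Z j)`. -/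
noncomputable def Zblk {n m : ℕ} (K : ℂ → Matrix (Fin n) (Fin n) ℂ)
    (B : ℂ → Matrix (Fin n) (Fin m) ℂ) (N : Fin m → ℂ → Matrix (Fin n) (Fin n) ℂ)
    (σ : ℕ → ℂ) : (j : ℕ) → Matrix (Fin n) (colT m j) ℂ
  | 0 => (K (σ 0))⁻¹ * B (σ 0)
  | j + 1 =>
      (K (σ (j + 1)))⁻¹ * Nbig N (σ j) *
        ((1 : Matrix (Fin m) (Fin m) ℂ) ⊗ₖ Zblk K B N σ j)

/-- The `q+1`-st subsystem transfer function `G_{q+1}(σ 0, …, σ q)`. -/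
noncomputable def Gblk {n m p : ℕ} (C : ℂ → Matrix (Fin p) (Fin n) ℂ)
    (K : ℂ → Matrix (Fin n) (Fin n) ℂ) (B : ℂ → Matrix (Fin n) (Fin m) ℂ)
    (N : Fin m → ℂ → Matrix (Fin n) (Fin n) ℂ) (σ : ℕ → ℂ) (q : ℕ) :
    Matrix (Fin p) (colT m q) ℂ :=
  C (σ q) * Zblk K B N σ q

/-- The tangential direction matrix `I_{m^j} ⊗ b`. -/
noncomputable def tangMat {m : ℕ} (b : Fin m → ℂ) :
    (j : ℕ) → Matrix (colT m j) (outT m j) ℂ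
  | 0 => Matrix.of fun i _ => b i
  | j + 1 => (1 : Matrix (Fin m) (Fin m) ℂ) ⊗ₖ tangMat b j

/-- Blockwise right interpolation matrices:
`V 0 = K(σ 0)⁻¹ B(σ 0) b`, `V (j+1) = K(σ (j+1))⁻¹ N(σ j) (I_m ⊗ V j)`. -/
noncomputable def Vblk {n m : ℕ} (K : ℂ → Matrix (Fin n) (Fin n) ℂ)
    (B : ℂ → Matrix (Fin n) (Fin m) ℂ) (N : Fin m → ℂ → Matrix (Fin n) (Fin n) ℂ)
    (σ : ℕ → ℂ) (b : Fin m → ℂ) : (j : ℕ) → Matrix (Fin n) (outT m j) ℂ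
  | 0 => Matrix.of fun i _ => ((K (σ 0))⁻¹ *ᵥ (B (σ 0) *ᵥ b)) i
  | j + 1 =>
      (K (σ (j + 1)))⁻¹ * Nbig N (σ j) *
        ((1 : Matrix (Fin m) (Fin m) ℂ) ⊗ₖ Vblk K B N σ b j)

/-- Blockwise left interpolation matrices (with reversed point sequence `τ`):
`W 0 = K(τ 0)^{-ᴴ} C(τ 0)ᴴ c`, `W (t+1) = K(τ (t+1))^{-ᴴ} Ñ(τ (t+1))ᴴ (I_m ⊗ W t)`. -/
noncomputable def Wblk {n m p : ℕ} (C : ℂ → Matrix (Fin p) (Fin n) ℂ)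
    (K : ℂ → Matrix (Fin n) (Fin n) ℂ) (N : Fin m → ℂ → Matrix (Fin n) (Fin n) ℂ)
    (τ : ℕ → ℂ) (c : Fin p → ℂ) : (t : ℕ) → Matrix (Fin n) (outT m t) ℂ
  | 0 => Matrix.of fun i _ => (((K (τ 0))⁻¹)ᴴ *ᵥ ((C (τ 0))ᴴ *ᵥ c)) i
  | t + 1 =>
      ((K (τ (t + 1)))⁻¹)ᴴ * (Ntil N (τ (t + 1)))ᴴ *
        ((1 : Matrix (Fin m) (Fin m) ℂ) ⊗ₖ Wblk C K N τ c t)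

/-- A vector as a one-column matrix. -/
noncomputable def bCol {m : ℕ} (b : Fin m → ℂ) : Matrix (Fin m) (Fin 1) ℂ :=
  Matrix.of fun i _ => b i

/-- Blockwise Hermite chain. -/
noncomputable def hChainB {n m : ℕ} (K : ℂ → Matrix (Fin n) (Fin n) ℂ)
    (B : ℂ → Matrix (Fin n) (Fin m) ℂ) (N : Fin m → ℂ → Matrix (Fin n) (Fin n) ℂ)
    (σ : ℕ → ℂ) (ℓ : ℕ → ℕ) (b : Fin m → ℂ) :
    (t : ℕ) → Matrix (Fin n) (outT m (t + 1)) ℂ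
  | 0 => mDeriv (ℓ 0)
      (fun z => Nbig N z * ((1 : Matrix (Fin m) (Fin m) ℂ) ⊗ₖ ((K z)⁻¹ * B z * bCol b)))
      (σ 0)
  | t + 1 =>
      mDeriv (ℓ (t + 1))
        (fun z => Nbig N z * ((1 : Matrix (Fin m) (Fin m) ℂ) ⊗ₖ (K z)⁻¹)) (σ (t + 1)) *
        ((1 : Matrix (Fin m) (Fin m) ℂ) ⊗ₖ hChainB K B N σ ℓ b t)

/-- Blockwise right Hermite interpolation matrices. -/
noncomputable def vHermB {n m : ℕ} (K : ℂ → Matrix (Fin n) (Fin n) ℂ)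
    (B : ℂ → Matrix (Fin n) (Fin m) ℂ) (N : Fin m → ℂ → Matrix (Fin n) (Fin n) ℂ)
    (σ : ℕ → ℂ) (ℓ : ℕ → ℕ) (b : Fin m → ℂ) : (t : ℕ) → ℕ → Matrix (Fin n) (outT m t) ℂ
  | 0, j => mDeriv j (fun z => (K z)⁻¹ * B z * bCol b) (σ 0)
  | t + 1, j => mDeriv j (fun z => (K z)⁻¹) (σ (t + 1)) * hChainB K B N σ ℓ b t

/-- Blockwise left Hermite interpolation matrices (with reversed sequences). -/
noncomputable def wHermB {n m p : ℕ} (C : ℂ → Matrix (Fin p) (Fin n) ℂ)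
    (K : ℂ → Matrix (Fin n) (Fin n) ℂ) (N : Fin m → ℂ → Matrix (Fin n) (Fin n) ℂ)
    (τ : ℕ → ℂ) (eν : ℕ → ℕ) (c : Fin p → ℂ) : (t : ℕ) → ℕ → Matrix (Fin n) (outT m t) ℂ
  | 0, i => Matrix.of fun idx _ =>
      star (iteratedDeriv i (fun z => Matrix.vecMul (star c) (C z * (K z)⁻¹) idx) (τ 0))
  | t + 1, j => Matrix.of fun idx cc =>
      star (iteratedDeriv j (fun z =>
        (((1 : Matrix (Fin m) (Fin m) ℂ) ⊗ₖ wHermB C K N τ eν c t (eν t))ᴴ * Ntil N z *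
          (K z)⁻¹) cc idx) (τ (t + 1)))

/-- The Kronecker product `d (j-1) ⊗ ⋯ ⊗ d 0 ⊗ I_m` of scaling vectors with the identity. -/
noncomputable def dKron {m : ℕ} (d : ℕ → Fin m → ℂ) :
    (j : ℕ) → Matrix (colT m j) (Fin m) ℂ
  | 0 => (1 : Matrix (Fin m) (Fin m) ℂ)
  | j + 1 => Matrix.of fun (pq : Fin m × colT m j) cix => d j pq.1 * dKron d j pq.2 cix

/-- The innermost (input) coordinate of a column multi-index. -/
def innerIdx (m : ℕ) : (j : ℕ) → colT m j → Fin m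
  | 0 => fun x => x
  | j + 1 => fun (pq : Fin m × colT m j) => innerIdx m j pq.2

/-- The chain `K(σ t)⁻¹ N_{J (t-1)}(σ (t-1)) ⋯ N_{J 0}(σ 0) K(σ 0)⁻¹ B(σ 0)`. -/
noncomputable def eChain {n m : ℕ} (K : ℂ → Matrix (Fin n) (Fin n) ℂ)
    (B : ℂ → Matrix (Fin n) (Fin m) ℂ) (N : Fin m → ℂ → Matrix (Fin n) (Fin n) ℂ)
    (σ : ℕ → ℂ) (J : ℕ → Fin m) : ℕ → Matrix (Fin n) (Fin m) ℂ
  | 0 => (K (σ 0))⁻¹ * B (σ 0)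
  | t + 1 => (K (σ (t + 1)))⁻¹ * N (J t) (σ t) * eChain K B N σ J t

theorem Nsum_compress {n m r : ℕ} (N : Fin m → ℂ → Matrix (Fin n) (Fin n) ℂ)
    (V W : Matrix (Fin n) (Fin r) ℂ) (s : ℂ) (d : Fin m → ℂ) :
    Nsum (fun ι s => Wᴴ * N ι s * V) s d = Wᴴ * Nsum N s d * V := by
  simp [Nsum, Matrix.mul_sum, Matrix.sum_mul]

/-- A Petrov–Galerkin projection reproduces solutions lying in the trial space. -/
theorem mulVec_compress_inv {n r : ℕ} {A : Matrix (Fin n) (Fin n) ℂ}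
    {V W : Matrix (Fin n) (Fin r) ℂ} (hA : IsUnit A.det) (hAr : IsUnit (Wᴴ * A * V).det)
    {y : Fin n → ℂ} (hy : A⁻¹ *ᵥ y ∈ Set.range V.mulVec) :
    V *ᵥ ((Wᴴ * A * V)⁻¹ *ᵥ (Wᴴ *ᵥ y)) = A⁻¹ *ᵥ y := by
  obtain ⟨x, hx⟩ := hy
  have hy' : y = A *ᵥ (V *ᵥ x) := by
    rw [hx, mulVec_mulVec, mul_nonsing_inv _ hA, one_mulVec]
  have hsol : (Wᴴ * A * V)⁻¹ *ᵥ (Wᴴ *ᵥ y) = x := by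
    rw [hy', mulVec_mulVec, mulVec_mulVec, mulVec_mulVec, Matrix.mul_assoc, Matrix.mul_assoc,
      ← Matrix.mul_assoc Wᴴ, nonsing_inv_mul _ hAr, one_mulVec]
  rw [hsol, hx]

theorem mulVec_compress_inv_conjTranspose {n r : ℕ} {A : Matrix (Fin n) (Fin n) ℂ}
    {V W : Matrix (Fin n) (Fin r) ℂ} (hA : IsUnit A.det) (hAr : IsUnit (Wᴴ * A * V).det)
    {y : Fin n → ℂ} (hy : (A⁻¹)ᴴ *ᵥ y ∈ Set.range W.mulVec) :
    W *ᵥ (((Wᴴ * A * V)⁻¹)ᴴ *ᵥ (Vᴴ *ᵥ y)) = (A⁻¹)ᴴ *ᵥ y := by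
  have hT : (Wᴴ * A * V)ᴴ = Vᴴ * Aᴴ * W := by
    simp [conjTranspose_mul, Matrix.mul_assoc]
  rw [conjTranspose_nonsing_inv] at hy ⊢
  rw [conjTranspose_nonsing_inv, hT]
  refine mulVec_compress_inv ?_ ?_ hy
  · rw [det_conjTranspose]
    exact hA.star
  · rw [← hT, det_conjTranspose]
    exact hAr.star

theorem gAux_mulVec {n m : ℕ} (K : ℂ → Matrix (Fin n) (Fin n) ℂ)
    (B : ℂ → Matrix (Fin n) (Fin m) ℂ) (N : Fin m → ℂ → Matrix (Fin n) (Fin n) ℂ)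
    (σ : ℕ → ℂ) (d : ℕ → Fin m → ℂ) (b : Fin m → ℂ) (j : ℕ) :
    gAux K B N σ d j *ᵥ b = vtan K B N σ d b j := by
  induction j with
  | zero => simp [gAux, vtan]
  | succ j ih => simp [gAux, vtan, ← ih, Matrix.mul_assoc]

theorem vtan_congr {n m : ℕ} (K : ℂ → Matrix (Fin n) (Fin n) ℂ)
    (B : ℂ → Matrix (Fin n) (Fin m) ℂ) (N : Fin m → ℂ → Matrix (Fin n) (Fin n) ℂ)
    {σ σ' : ℕ → ℂ} {d d' : ℕ → Fin m → ℂ} (b : Fin m → ℂ) {q : ℕ}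
    (hσ : ∀ j ≤ q, σ j = σ' j) (hd : ∀ j < q, d j = d' j) :
    vtan K B N σ d b q = vtan K B N σ' d' b q := by
  induction q with
  | zero => simp [vtan, hσ 0 le_rfl]
  | succ q ih =>
    simp only [vtan]
    rw [hσ (q + 1) le_rfl, hσ q q.le_succ, hd q q.lt_succ_self,
      ih (fun j hj => hσ j (hj.trans q.le_succ)) (fun j hj => hd j (hj.trans q.lt_succ_self))]

theorem mulVec_vtan_compress {n m r : ℕ} {K : ℂ → Matrix (Fin n) (Fin n) ℂ}
    {B : ℂ → Matrix (Fin n) (Fin m) ℂ} {N : Fin m → ℂ → Matrix (Fin n) (Fin n) ℂ}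
    {V W : Matrix (Fin n) (Fin r) ℂ} {k : ℕ} {σ : ℕ → ℂ} {d : ℕ → Fin m → ℂ} {b : Fin m → ℂ}
    (hK : ∀ j < k, IsUnit (K (σ j)).det)
    (hKr : ∀ j < k, IsUnit (Wᴴ * K (σ j) * V).det)
    (hV : ∀ j < k, vtan K B N σ d b j ∈ Set.range V.mulVec) {j : ℕ} (hj : j < k) :
    V *ᵥ vtan (fun s => Wᴴ * K s * V) (fun s => Wᴴ * B s) (fun ι s => Wᴴ * N ι s * V) σ d b j =
      vtan K B N σ d b j := by
  induction j with
  | zero =>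
    have h := mulVec_compress_inv (hK 0 hj) (hKr 0 hj) (hV 0 hj)
    simpa only [vtan, mulVec_mulVec, Matrix.mul_assoc] using h
  | succ j ih =>
    have h := mulVec_compress_inv (hK _ hj) (hKr _ hj) (hV _ hj)
    simp only [vtan, Nsum_compress]
    rw [← mulVec_mulVec, ih (j.lt_succ_self.trans hj), ← mulVec_mulVec]
    exact h

theorem mulVec_wtan_compress {n m p r : ℕ} {C : ℂ → Matrix (Fin p) (Fin n) ℂ}
    {K : ℂ → Matrix (Fin n) (Fin n) ℂ} {N : Fin m → ℂ → Matrix (Fin n) (Fin n) ℂ}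
    {V W : Matrix (Fin n) (Fin r) ℂ} {κ : ℕ} {τ : ℕ → ℂ} {e : ℕ → Fin m → ℂ} {c : Fin p → ℂ}
    (hK : ∀ t < κ, IsUnit (K (τ t)).det)
    (hKr : ∀ t < κ, IsUnit (Wᴴ * K (τ t) * V).det)
    (hW : ∀ t < κ, wtan C K N τ e c t ∈ Set.range W.mulVec) {t : ℕ} (ht : t < κ) :
    W *ᵥ wtan (fun s => C s * V) (fun s => Wᴴ * K s * V) (fun ι s => Wᴴ * N ι s * V) τ e c t =
      wtan C K N τ e c t := by
  induction t with
  | zero =>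
    have h := mulVec_compress_inv_conjTranspose (hK 0 ht) (hKr 0 ht) (hW 0 ht)
    simp only [wtan]
    rw [conjTranspose_mul, ← mulVec_mulVec]
    exact h
  | succ t ih =>
    have h := mulVec_compress_inv_conjTranspose (hK _ ht) (hKr _ ht) (hW _ ht)
    simp only [wtan, Nsum_compress]
    rw [conjTranspose_mul, conjTranspose_mul, conjTranspose_conjTranspose, ← mulVec_mulVec,
      ← mulVec_mulVec, ih (t.lt_succ_self.trans ht)]
    exact h

theorem star_conjTranspose_mulVec_dotProduct {α β : Type*} [Fintype α] [Fintype β]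
    (A : Matrix α β ℂ) (x : α → ℂ) (y : β → ℂ) :
    star (Aᴴ *ᵥ x) ⬝ᵥ y = star x ⬝ᵥ (A *ᵥ y) := by
  rw [star_mulVec, conjTranspose_conjTranspose, dotProduct_mulVec]

/-- The transfer function splits into a left chain, a coupling term and a right chain. -/
theorem dotProduct_Gmod_mulVec {n m p : ℕ} (C : ℂ → Matrix (Fin p) (Fin n) ℂ)
    (K : ℂ → Matrix (Fin n) (Fin n) ℂ) (B : ℂ → Matrix (Fin n) (Fin m) ℂ)
    (N : Fin m → ℂ → Matrix (Fin n) (Fin n) ℂ) {s τ : ℕ → ℂ} {f e : ℕ → Fin m → ℂ}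
    (b : Fin m → ℂ) (c : Fin p → ℂ) {q η : ℕ}
    (hτ : ∀ i t, i + t = η → τ t = s (q + 1 + i))
    (he : ∀ i t, i + t + 1 = η → e t = f (q + 1 + i)) :
    star c ⬝ᵥ (Gmod C K B N s f (q + η + 1) *ᵥ b) =
      star (wtan C K N τ e c η) ⬝ᵥ (Nsum N (s q) (f q) *ᵥ vtan K B N s f b q) := by
  induction η generalizing q with
  | zero =>
    simp only [wtan, star_conjTranspose_mulVec_dotProduct]
    rw [hτ 0 0 rfl, Gmod, ← mulVec_mulVec, gAux_mulVec]
    rfl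
  | succ η ih =>
    have h := ih (q := q + 1)
      (fun i t hit => by rw [hτ (i + 1) t (by omega)]; congr 1; omega)
      (fun i t hit => by rw [he (i + 1) t (by omega)]; congr 1; omega)
    simp only [wtan, star_conjTranspose_mulVec_dotProduct]
    rw [hτ 0 (η + 1) (by omega), he 0 η (by omega), show q + (η + 1) + 1 = q + 1 + η + 1 by omega, h]
    rfl

theorem stmt_2 {n m p r : ℕ} (hn : 0 < n) (hm : 0 < m) (hp : 0 < p) (hr : 0 < r)
    (C : ℂ → Matrix (Fin p) (Fin n) ℂ) (K : ℂ → Matrix (Fin n) (Fin n) ℂ)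
    (B : ℂ → Matrix (Fin n) (Fin m) ℂ) (N : Fin m → ℂ → Matrix (Fin n) (Fin n) ℂ)
    (V W : Matrix (Fin n) (Fin r) ℂ)
    (k κ : ℕ) (hk : 0 < k) (hκ : 0 < κ) (σ ς : ℕ → ℂ) (d δ : ℕ → Fin m → ℂ)
    (b : Fin m → ℂ) (c : Fin p → ℂ)
    (hK : ∀ j < k, IsUnit (K (σ j)).det)
    (hK' : ∀ i < κ, IsUnit (K (ς i)).det)
    (hKr : ∀ j < k, IsUnit (Wᴴ * K (σ j) * V).det)
    (hKr' : ∀ i < κ, IsUnit (Wᴴ * K (ς i) * V).det)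
    (hV : ∀ j < k, vtan K B N σ d b j ∈ Set.range V.mulVec)
    (hW : ∀ t < κ,
      wtan C K N (fun t => ς (κ - 1 - t)) (fun t => δ (κ - 2 - t)) c t ∈
        Set.range W.mulVec) :
    ∀ q < k, ∀ η < κ, ∀ z : Fin m → ℂ,
      star c ⬝ᵥ
          (Gmod C K B N (fun j => if j ≤ q then σ j else ς (κ - 1 - η + (j - (q + 1))))
            (fun j =>
              if j < q then d j else if j = q then z else δ (κ - 1 - η + (j - (q + 1))))
            (q + η + 1) *ᵥ b) =
        star c ⬝ᵥ
          (Gmod (fun s => C s * V) (fun s => Wᴴ * K s * V) (fun s => Wᴴ * B s) (fun ι s => Wᴴ * N ι s * V)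
            (fun j => if j ≤ q then σ j else ς (κ - 1 - η + (j - (q + 1))))
            (fun j =>
              if j < q then d j else if j = q then z else δ (κ - 1 - η + (j - (q + 1))))
            (q + η + 1) *ᵥ b) := by
  intro q hq η hη z
  set s : ℕ → ℂ := fun j => if j ≤ q then σ j else ς (κ - 1 - η + (j - (q + 1))) with hs
  set f : ℕ → Fin m → ℂ := fun j =>
    if j < q then d j else if j = q then z else δ (κ - 1 - η + (j - (q + 1))) with hf
  have hτ : ∀ i t, i + t = η → ς (κ - 1 - t) = s (q + 1 + i) := by
    intro i t hit
    simp only [hs]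
    rw [if_neg (by omega)]
    congr 1
    omega
  have he : ∀ i t, i + t + 1 = η → δ (κ - 2 - t) = f (q + 1 + i) := by
    intro i t hit
    simp only [hf]
    rw [if_neg (by omega), if_neg (by omega)]
    congr 1
    omega
  have hsσ : ∀ j ≤ q, s j = σ j := fun j hj => if_pos hj
  have hfd : ∀ j < q, f j = d j := fun j hj => if_pos hj
  rw [dotProduct_Gmod_mulVec C K B N b c (τ := fun t => ς (κ - 1 - t))
      (e := fun t => δ (κ - 2 - t)) hτ he,
    dotProduct_Gmod_mulVec _ _ _ _ b c (τ := fun t => ς (κ - 1 - t))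
      (e := fun t => δ (κ - 2 - t)) hτ he,
    vtan_congr _ _ _ b hsσ hfd, vtan_congr _ _ _ b hsσ hfd,
    ← mulVec_vtan_compress hK hKr hV hq,
    ← mulVec_wtan_compress (fun t _ => hK' (κ - 1 - t) (by omega))
      (fun t _ => hKr' (κ - 1 - t) (by omega)) hW hη,
    Nsum_compress, ← mulVec_mulVec, ← mulVec_mulVec, ← star_conjTranspose_mulVec_dotProduct Wᴴ,
    conjTranspose_conjTranspose]

end StructBilin
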